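/- arXiv:1707.09164 — 4 statements merged into one kernel-verified Lean document; each statement's English description precedes it below -/
import Mathlib

section
/- Let B be a Bol superalgebra over a field K of characteristic 0. For r ∈ Z₂ let PS_r(B) be the set of pairs (P,a) where P is a pseudo superderivation of B of degree r and a is a companion of P, and let PS(B) = PS₀(B) ⊕ PS₁(B), with |(P,a)| := r for (P,a) ∈ PS_r(B). Then PS(B), equipped with the bracket [(P,a),(Q,b)] := (P∘Q − (−1)^{|(P,a)||(Q,b)|} Q∘P, P(b) − (−1)^{|(P,a)||(Q,b)|} Q(a) − a·b), is a Lie superalgebra: the bracket of PS_r(B) and PS_s(B) lands in PS_{r+s}(B), is super skew-symmetric, and satisfies the super Jacobi identity. -/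
open LinearMap

/-- The sign `(-1)^(i·j)` in the ground field, for parities `i j : ZMod 2`. -/
def sgn (K : Type*) [Field K] (i j : ZMod 2) : K := (-1 : K) ^ (i * j).val

/-- A Bol superalgebra over `K`: a `ZMod 2`-graded vector space with a bilinear
product `mul` and a trilinear bracket `tri` satisfying (BS1)–(BS5) on
homogeneous elements. -/
structure BolSuper (K : Type*) (B : Type*) [Field K] [AddCommGroup B] [Module K B] where
  g : ZMod 2 → Submodule K B
  internal : DirectSum.IsInternal g
  mul : B →ₗ[K] B →ₗ[K] B
  tri : B →ₗ[K] B →ₗ[K] B →ₗ[K] B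
  mul_mem : ∀ i j x y, x ∈ g i → y ∈ g j → mul x y ∈ g (i + j)
  tri_mem : ∀ i j k x y z, x ∈ g i → y ∈ g j → z ∈ g k → tri x y z ∈ g (i + j + k)
  bs1 : ∀ i j x y, x ∈ g i → y ∈ g j → mul x y = -(sgn K i j • mul y x)
  bs2 : ∀ i j k x y z, x ∈ g i → y ∈ g j → z ∈ g k → tri x y z = -(sgn K i j • tri y x z)
  bs3 : ∀ i j k x y z, x ∈ g i → y ∈ g j → z ∈ g k →
    tri x y z + sgn K i (j + k) • tri y z x + sgn K k (i + j) • tri z x y = 0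
  bs4 : ∀ i j k l m x y u v w, x ∈ g i → y ∈ g j → u ∈ g k → v ∈ g l → w ∈ g m →
    tri x y (tri u v w) = tri (tri x y u) v w + sgn K k (i + j) • tri u (tri x y v) w
      + sgn K (i + j) (k + l) • tri u v (tri x y w)
  bs5 : ∀ i j k l x y u v, x ∈ g i → y ∈ g j → u ∈ g k → v ∈ g l →
    tri x y (mul u v) = sgn K k (i + j) • mul u (tri x y v) + mul (tri x y u) v
      + sgn K (i + j) (k + l) • tri u v (mul x y) + mul (mul x y) (mul u v)

variable {K B L : Type*} [Field K] [AddCommGroup B] [Module K B]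

/-- `P` is a pseudo superderivation of degree `r` of the Bol superalgebra `A`
with companion `a ∈ A.g r`. -/
def IsPSD (A : BolSuper K B) (r : ZMod 2) (P : B →ₗ[K] B) (a : B) : Prop :=
  a ∈ A.g r ∧
  (∀ i x, x ∈ A.g i → P x ∈ A.g (i + r)) ∧
  (∀ i j k x y z, x ∈ A.g i → y ∈ A.g j → z ∈ A.g k →
    P (A.tri x y z) = A.tri (P x) y z + sgn K r i • A.tri x (P y) z
      + sgn K r (i + j) • A.tri x y (P z)) ∧
  (∀ i j x y, x ∈ A.g i → y ∈ A.g j →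
    P (A.mul x y) = sgn K r i • A.mul x (P y) + A.mul (P x) y
      + sgn K r (i + j) • A.tri x y a + A.mul a (A.mul x y))

/-- The bracket on pairs (pseudo superderivation, companion), for degrees `r`, `s`. -/
def pbrk (A : BolSuper K B) (r s : ZMod 2)
    (pa qb : (B →ₗ[K] B) × B) : (B →ₗ[K] B) × B :=
  (pa.1 ∘ₗ qb.1 - sgn K r s • (qb.1 ∘ₗ pa.1),
   pa.1 qb.2 - sgn K r s • qb.1 pa.2 - A.mul pa.2 qb.2)

/-- The bracket on `B ⊕ H` (elements encoded as pairs `(x, (P, a))`),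
for degrees `r`, `s`. -/
def lbrk (A : BolSuper K B) (r s : ZMod 2)
    (u v : B × ((B →ₗ[K] B) × B)) : B × ((B →ₗ[K] B) × B) :=
  (u.2.1 v.1 - sgn K r s • v.2.1 u.1,
   (A.tri u.1 v.1 + (pbrk A r s u.2 v.2).1,
    A.mul u.1 v.1 + (pbrk A r s u.2 v.2).2))

/-- The degree-`r` part of the span of the inner pairs `(D_{x,u}, x·u)` with
`x` homogeneous in `B` and `u` homogeneous in the graded subspace `S`. -/
def IPSpan (A : BolSuper K B) (S : ZMod 2 → Submodule K B) (r : ZMod 2) :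
    Submodule K ((B →ₗ[K] B) × B) :=
  Submodule.span K {pa | ∃ i j x u, i + j = r ∧ x ∈ A.g i ∧ u ∈ S j ∧
    pa = (A.tri x u, A.mul x u)}

/-- Data presenting a Lie superalgebra `L` as the standard enveloping Lie
superalgebra `L(B) = B ⊕ IPS(B,B)` of the Bol superalgebra `A`, together with
the grading involution `sigma` used to define supertraces. -/
structure EnvSetup (K B L : Type*) [Field K] [AddCommGroup B] [Module K B]
    [AddCommGroup L] [Module K L] (A : BolSuper K B) where
  brk : L →ₗ[K] L →ₗ[K] L
  iota : B →ₗ[K] L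
  jmap : ((B →ₗ[K] B) × B) →ₗ[K] L
  gL : ZMod 2 → Submodule K L
  gL_eq : ∀ r, gL r = (A.g r).map iota ⊔ (IPSpan A A.g r).map jmap
  surj : ∀ v : L, ∃ x pa, pa ∈ IPSpan A A.g 0 ⊔ IPSpan A A.g 1 ∧ v = iota x + jmap pa
  inj : ∀ x pa, pa ∈ IPSpan A A.g 0 ⊔ IPSpan A A.g 1 → iota x + jmap pa = 0 →
    x = 0 ∧ pa = 0
  brk_bb : ∀ x y : B, brk (iota x) (iota y) = jmap (A.tri x y, A.mul x y)
  brk_pb : ∀ r pa, pa ∈ IPSpan A A.g r → ∀ x : B, brk (jmap pa) (iota x) = iota (pa.1 x)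
  brk_bp : ∀ r s x pa, x ∈ A.g r → pa ∈ IPSpan A A.g s →
    brk (iota x) (jmap pa) = -(sgn K r s • iota (pa.1 x))
  brk_pp : ∀ r s pa qb, pa ∈ IPSpan A A.g r → qb ∈ IPSpan A A.g s →
    brk (jmap pa) (jmap qb) = jmap (pbrk A r s pa qb)
  sigma : L →ₗ[K] L
  sigma0 : ∀ v ∈ gL 0, sigma v = v
  sigma1 : ∀ v ∈ gL 1, sigma v = -v

variable [AddCommGroup L] [Module K L]

/-- The Killing form `α(u,v) = str(ad u ∘ ad v)` of the enveloping Lie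
superalgebra, the supertrace being computed via the grading involution. -/
noncomputable def killing {A : BolSuper K B} (E : EnvSetup K B L A) (u v : L) : K :=
  LinearMap.trace K L (E.sigma ∘ₗ E.brk u ∘ₗ E.brk v)

/-- The Killing-Ricci form of `B`: the restriction of the Killing form of the
standard enveloping Lie superalgebra to `B × B`. -/
noncomputable def kr {A : BolSuper K B} (E : EnvSetup K B L A) (x y : B) : K :=
  killing E (E.iota x) (E.iota y)

theorem sgn_eq_one_or (K : Type*) [Field K] (i j : ZMod 2) : sgn K i j = 1 ∨ sgn K i j = -1 :=
  neg_one_pow_eq_or K _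

theorem sgn_comm (K : Type*) [Field K] (i j : ZMod 2) : sgn K i j = sgn K j i := by
  simp only [sgn, mul_comm]

theorem sgn_add_right (K : Type*) [Field K] (i j k : ZMod 2) :
    sgn K i (j + k) = sgn K i j * sgn K i k := by
  simp only [sgn, ← pow_add]
  rw [neg_one_pow_eq_pow_mod_two, neg_one_pow_eq_pow_mod_two (_ + _)]
  congr 1
  revert i j k
  decide

theorem sgn_add_left (K : Type*) [Field K] (i j k : ZMod 2) :
    sgn K (i + j) k = sgn K i k * sgn K j k := by
  rw [sgn_comm, sgn_add_right, sgn_comm K k, sgn_comm K k]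

theorem pbrk_skew (A : BolSuper K B) {r s : ZMod 2} {pa qb : (B →ₗ[K] B) × B}
    (ha : pa.2 ∈ A.g r) (hb : qb.2 ∈ A.g s) :
    pbrk A r s pa qb = -(sgn K r s • pbrk A s r qb pa) := by
  have h := A.bs1 r s _ _ ha hb
  rw [pbrk, pbrk, sgn_comm K s r, h]
  ext
  · rcases sgn_eq_one_or K r s with e | e <;> simp [e, add_comm]
  · rcases sgn_eq_one_or K r s with e | e <;> simp only [e, Prod.snd_neg, Prod.smul_snd] <;> module

set_option maxHeartbeats 4000000 in
theorem IsPSD.pbrk_mul {A : BolSuper K B} {r s : ZMod 2} {P Q : B →ₗ[K] B} {a b : B}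
    (hP : IsPSD A r P a) (hQ : IsPSD A s Q b) {i j : ZMod 2} {x y : B}
    (hx : x ∈ A.g i) (hy : y ∈ A.g j) :
    (pbrk A r s (P, a) (Q, b)).1 (A.mul x y) =
      sgn K (r + s) i • A.mul x ((pbrk A r s (P, a) (Q, b)).1 y)
      + A.mul ((pbrk A r s (P, a) (Q, b)).1 x) y
      + sgn K (r + s) (i + j) • A.tri x y (pbrk A r s (P, a) (Q, b)).2
      + A.mul (pbrk A r s (P, a) (Q, b)).2 (A.mul x y) := by
  obtain ⟨ha, hPg, hPt, hPm⟩ := hP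
  obtain ⟨hb, hQg, hQt, hQm⟩ := hQ
  have hxy := A.mul_mem _ _ _ _ hx hy
  have hab := A.mul_mem _ _ _ _ ha hb
  have h5 := A.bs5 _ _ _ _ _ _ _ _ hx hy ha hb
  have h1 := A.bs1 _ _ _ _ (A.tri_mem _ _ _ _ _ _ hx hy ha) hb
  have h1' := A.bs1 _ _ _ _ hab hxy
  have h3 := A.bs3 _ _ _ _ _ _ ha hb hxy
  have h2 := A.bs2 _ _ _ _ _ _ ha hxy hb
  simp only [pbrk, LinearMap.sub_apply, LinearMap.smul_apply, LinearMap.comp_apply, map_sub,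
    map_smul]
  rw [hQm _ _ _ _ hx hy, hPm _ _ _ _ hx hy]
  simp only [map_add, map_smul]
  rw [hPm _ _ _ _ hx (hQg _ _ hy), hPm _ _ _ _ (hQg _ _ hx) hy, hPt _ _ _ _ _ _ hx hy hb,
    hPm _ _ _ _ hb hxy, hPm _ _ _ _ hx hy,
    hQm _ _ _ _ hx (hPg _ _ hy), hQm _ _ _ _ (hPg _ _ hx) hy, hQt _ _ _ _ _ _ hx hy ha,
    hQm _ _ _ _ ha hxy, hQm _ _ _ _ hx hy]
  simp only [map_add, map_smul, sgn_add_left, sgn_add_right, sgn_comm K s r, sgn_comm K i,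
    sgn_comm K j] at h5 h1 h1' h3 h2 ⊢
  rcases sgn_eq_one_or K r s with e₁ | e₁ <;> rcases sgn_eq_one_or K r i with e₂ | e₂ <;>
  rcases sgn_eq_one_or K r j with e₃ | e₃ <;> rcases sgn_eq_one_or K s i with e₄ | e₄ <;>
  rcases sgn_eq_one_or K s j with e₅ | e₅ <;>
  linear_combination (norm := (simp only [e₁, e₂, e₃, e₄, e₅]; module))
    (sgn K r i * sgn K r j * sgn K s i * sgn K s j) • h5
    + (sgn K r i * sgn K r j * sgn K s i * sgn K s j) • h1 + h1' + h3
    - (sgn K s i * sgn K s j) • h2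

set_option maxHeartbeats 4000000 in
theorem IsPSD.pbrk_tri {A : BolSuper K B} {r s : ZMod 2} {P Q : B →ₗ[K] B} {a b : B}
    (hP : IsPSD A r P a) (hQ : IsPSD A s Q b) {i j k : ZMod 2} {x y z : B}
    (hx : x ∈ A.g i) (hy : y ∈ A.g j) (hz : z ∈ A.g k) :
    (pbrk A r s (P, a) (Q, b)).1 (A.tri x y z) =
      A.tri ((pbrk A r s (P, a) (Q, b)).1 x) y z
      + sgn K (r + s) i • A.tri x ((pbrk A r s (P, a) (Q, b)).1 y) z
      + sgn K (r + s) (i + j) • A.tri x y ((pbrk A r s (P, a) (Q, b)).1 z) := by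
  obtain ⟨-, hPg, hPt, -⟩ := hP
  obtain ⟨-, hQg, hQt, -⟩ := hQ
  simp only [pbrk, LinearMap.sub_apply, LinearMap.smul_apply, LinearMap.comp_apply, map_sub,
    map_smul]
  rw [hQt _ _ _ _ _ _ hx hy hz, hPt _ _ _ _ _ _ hx hy hz]
  simp only [map_add, map_smul]
  rw [hPt _ _ _ _ _ _ (hQg _ _ hx) hy hz, hPt _ _ _ _ _ _ hx (hQg _ _ hy) hz,
    hPt _ _ _ _ _ _ hx hy (hQg _ _ hz),
    hQt _ _ _ _ _ _ (hPg _ _ hx) hy hz, hQt _ _ _ _ _ _ hx (hPg _ _ hy) hz,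
    hQt _ _ _ _ _ _ hx hy (hPg _ _ hz)]
  simp only [sgn_add_left, sgn_add_right, sgn_comm K s r]
  rcases sgn_eq_one_or K r s with e₁ | e₁ <;> rcases sgn_eq_one_or K r i with e₂ | e₂ <;>
  rcases sgn_eq_one_or K r j with e₃ | e₃ <;> rcases sgn_eq_one_or K s i with e₄ | e₄ <;>
  rcases sgn_eq_one_or K s j with e₅ | e₅ <;>
  simp only [e₁, e₂, e₃, e₄, e₅] <;> module

theorem IsPSD.pbrk {A : BolSuper K B} {r s : ZMod 2} {P Q : B →ₗ[K] B} {a b : B}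
    (hP : IsPSD A r P a) (hQ : IsPSD A s Q b) :
    IsPSD A (r + s) (pbrk A r s (P, a) (Q, b)).1 (pbrk A r s (P, a) (Q, b)).2 := by
  refine ⟨?_, fun i x hx => ?_, fun i j k x y z hx hy hz => hP.pbrk_tri hQ hx hy hz,
    fun i j x y hx hy => hP.pbrk_mul hQ hx hy⟩
  · refine sub_mem (sub_mem ?_ (Submodule.smul_mem _ _ (hQ.2.1 _ _ hP.1)))
      (A.mul_mem _ _ _ _ hP.1 hQ.1)
    exact add_comm r s ▸ hP.2.1 _ _ hQ.1
  · refine sub_mem ?_ (Submodule.smul_mem _ _ ?_)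
    · exact (by abel : i + s + r = i + (r + s)) ▸ hP.2.1 _ _ (hQ.2.1 _ _ hx)
    · exact add_assoc i r s ▸ hQ.2.1 _ _ (hP.2.1 _ _ hx)

theorem pbrk_jacobi {A : BolSuper K B} {r s t : ZMod 2} {P Q R : B →ₗ[K] B} {a b c : B}
    (hP : IsPSD A r P a) (hQ : IsPSD A s Q b) (hR : IsPSD A t R c) :
    pbrk A (r + s) t (pbrk A r s (P, a) (Q, b)) (R, c)
      + sgn K r (s + t) • pbrk A (s + t) r (pbrk A s t (Q, b) (R, c)) (P, a)
      + sgn K t (r + s) • pbrk A (t + r) s (pbrk A t r (R, c) (P, a)) (Q, b) = 0 := by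
  obtain ⟨ha, hPg, -, hPm⟩ := hP
  obtain ⟨hb, hQg, -, hQm⟩ := hQ
  obtain ⟨hc, hRg, -, hRm⟩ := hR
  have h3 := A.bs3 _ _ _ _ _ _ ha hb hc
  have habc := A.bs1 _ _ _ _ (A.mul_mem _ _ _ _ ha hb) hc
  have hbca := A.bs1 _ _ _ _ (A.mul_mem _ _ _ _ hb hc) ha
  have hcab := A.bs1 _ _ _ _ (A.mul_mem _ _ _ _ hc ha) hb
  have haR := A.bs1 _ _ _ _ ha (hRg _ _ hb)
  have hbP := A.bs1 _ _ _ _ hb (hPg _ _ hc)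
  have hcQ := A.bs1 _ _ _ _ hc (hQg _ _ ha)
  simp only [pbrk]
  ext x
  · simp only [Prod.fst_add, Prod.smul_fst, Prod.fst_zero, LinearMap.add_apply,
      LinearMap.sub_apply, LinearMap.smul_apply, LinearMap.comp_apply, map_sub, map_smul,
      LinearMap.zero_apply, sgn_add_left, sgn_add_right, sgn_comm K s r, sgn_comm K t]
    rcases sgn_eq_one_or K r s with e₁ | e₁ <;> rcases sgn_eq_one_or K r t with e₂ | e₂ <;>
    rcases sgn_eq_one_or K s t with e₃ | e₃ <;> simp only [e₁, e₂, e₃] <;> module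
  · simp only [Prod.snd_add, Prod.smul_snd, Prod.snd_zero,
      LinearMap.sub_apply, LinearMap.smul_apply, LinearMap.comp_apply, map_sub, map_smul]
    rw [hPm _ _ _ _ hb hc, hQm _ _ _ _ hc ha, hRm _ _ _ _ ha hb]
    simp only [sgn_add_left, sgn_add_right, sgn_comm K s r, sgn_comm K t] at h3 habc hbca hcab haR hbP hcQ ⊢
    rcases sgn_eq_one_or K r s with e₁ | e₁ <;> rcases sgn_eq_one_or K r t with e₂ | e₂ <;>
    rcases sgn_eq_one_or K s t with e₃ | e₃ <;>
    linear_combination (norm := (simp only [e₁, e₂, e₃]; module))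
      h3 + habc + (sgn K r s * sgn K r t) • hbca + (sgn K r t * sgn K s t) • hcab
      + sgn K s t • haR + sgn K r s • hbP + (sgn K r t * sgn K r s * sgn K s t) • hcQ

/-- `PS(B)`, the graded space of pairs (pseudo superderivation,
companion) with the bracket `[(P,a),(Q,b)] = (P∘Q - (-1)^{rs}Q∘P,
P(b) - (-1)^{rs}Q(a) - a·b)`, is a Lie superalgebra: the bracket of elements of
degrees `r` and `s` lands in degree `r+s`, is super skew-symmetric and
satisfies the super Jacobi identity. -/
theorem stmt2 {K B : Type*} [Field K] [CharZero K] [AddCommGroup B] [Module K B]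
    (A : BolSuper K B) :
    (∀ (r s : ZMod 2) (pa qb : (B →ₗ[K] B) × B),
      IsPSD A r pa.1 pa.2 → IsPSD A s qb.1 qb.2 →
      IsPSD A (r + s) (pbrk A r s pa qb).1 (pbrk A r s pa qb).2) ∧
    (∀ (r s : ZMod 2) (pa qb : (B →ₗ[K] B) × B),
      IsPSD A r pa.1 pa.2 → IsPSD A s qb.1 qb.2 →
      pbrk A r s pa qb = -(sgn K r s • pbrk A s r qb pa)) ∧
    (∀ (r s t : ZMod 2) (pa qb rc : (B →ₗ[K] B) × B),
      IsPSD A r pa.1 pa.2 → IsPSD A s qb.1 qb.2 → IsPSD A t rc.1 rc.2 →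
      pbrk A (r + s) t (pbrk A r s pa qb) rc
        + sgn K r (s + t) • pbrk A (s + t) r (pbrk A s t qb rc) pa
        + sgn K t (r + s) • pbrk A (t + r) s (pbrk A t r rc pa) qb = 0) := by
  exact ⟨fun _ _ _ _ hP hQ => hP.pbrk hQ, fun _ _ _ _ hP hQ => pbrk_skew A hP.1 hQ.1,
    fun _ _ _ _ _ _ hP hQ hR => pbrk_jacobi hP hQ hR⟩
end

section
/- Let B be a Bol superalgebra over a field K of characteristic 0 and let L(B) = B ⊕ IPS(B,B) be its standard enveloping Lie superalgebra. If J is an ideal of B, i.e. a graded subspace with B·J ⊆ J, [B,B,J] ⊆ J and [B,J,B] ⊆ J, then 𝒥 = J ⊕ IPS(B,J) is an ideal of L(B), i.e. [𝒥, L(B)] ⊆ 𝒥, where IPS(B,J) denotes the graded span of the pairs (D_{x,u}, x·u) for homogeneous x ∈ B and u ∈ J. -/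
open LinearMap

variable {K B L : Type*} [Field K] [AddCommGroup B] [Module K B]

variable [AddCommGroup L] [Module K L]

namespace BolSuper

theorem sgn_comm (K : Type*) [Field K] (i j : ZMod 2) : sgn K i j = sgn K j i := by
  simp [sgn, mul_comm]

theorem sgn_mul_self (K : Type*) [Field K] (i j : ZMod 2) : sgn K i j * sgn K i j = 1 := by
  simp [sgn, ← mul_pow]

/-- Linear maps out of a Bol superalgebra are determined by their values on homogeneous elements. -/
theorem hom_ext_of_homogeneous {K B M : Type*} [Field K] [AddCommGroup B] [Module K B]
    [AddCommGroup M] [Module K M] (A : BolSuper K B) {f g : B →ₗ[K] M}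
    (h : ∀ i, ∀ x ∈ A.g i, f x = g x) : f = g := by
  have htop : (⊤ : Submodule K B) ≤ LinearMap.eqLocus f g := by
    rw [← A.internal.submodule_iSup_eq_top]
    exact iSup_le h
  exact LinearMap.ext fun x => htop (Submodule.mem_top (x := x))

section

variable {K B : Type*} [Field K] [AddCommGroup B] [Module K B] (A : BolSuper K B)

theorem tri_skew {i j : ZMod 2} {x y : B} (hx : x ∈ A.g i) (hy : y ∈ A.g j) :
    A.tri x y = -(sgn K i j • A.tri y x) :=
  A.hom_ext_of_homogeneous fun k z hz => by simpa using A.bs2 i j k x y z hx hy hz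

theorem inner_mem {S : ZMod 2 → Submodule K B} {i j r : ZMod 2} {x u : B} (hr : i + j = r)
    (hx : x ∈ A.g i) (hu : u ∈ S j) : (A.tri x u, A.mul x u) ∈ IPSpan A S r :=
  Submodule.subset_span ⟨i, j, x, u, hr, hx, hu, rfl⟩

/-- The commutator of `D_{y,z}` with `D_{x,u}`, together with its companion, is obtained by
letting `D_{y,z}` act on `x` and `u` as a superderivation. -/
theorem pbrk_inner {i j k l : ZMod 2} {y z x u : B} (hy : y ∈ A.g i) (hz : z ∈ A.g j)
    (hx : x ∈ A.g k) (hu : u ∈ A.g l) :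
    pbrk A (i + j) (k + l) (A.tri y z, A.mul y z) (A.tri x u, A.mul x u) =
      (A.tri (A.tri y z x) u, A.mul (A.tri y z x) u) +
        sgn K k (i + j) • (A.tri x (A.tri y z u), A.mul x (A.tri y z u)) := by
  refine Prod.ext (A.hom_ext_of_homogeneous fun m w hw => ?_) ?_
  · have h := A.bs4 i j k l m y z x u w hy hz hx hu hw
    simp [pbrk, h]
  · have h := A.bs5 i j k l y z x u hy hz hx hu
    simp only [pbrk, Prod.snd_add, Prod.smul_snd, h]
    abel

theorem pbrk_skew {r s : ZMod 2} {P Q : B →ₗ[K] B} {a b : B} (ha : a ∈ A.g r) (hb : b ∈ A.g s) :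
    pbrk A r s (P, a) (Q, b) = -(sgn K r s • pbrk A s r (Q, b) (P, a)) := by
  have h := A.bs1 r s a b ha hb
  refine Prod.ext ?_ ?_
  · simp [pbrk, smul_sub, smul_smul, sgn_comm K s r, sgn_mul_self]
  · simp only [pbrk, h, sgn_comm K s r, Prod.snd_neg, Prod.smul_snd, smul_sub, smul_smul,
      sgn_mul_self, one_smul]
    abel

theorem pbrk_add_left (r s : ZMod 2) (p p' q : (B →ₗ[K] B) × B) :
    pbrk A r s (p + p') q = pbrk A r s p q + pbrk A r s p' q := by
  refine Prod.ext ?_ ?_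
  · simp only [pbrk, Prod.fst_add, LinearMap.add_comp, LinearMap.comp_add, smul_add]
    abel
  · simp only [pbrk, Prod.fst_add, Prod.snd_add, LinearMap.add_apply, map_add, smul_add]
    abel

theorem pbrk_smul_left (r s : ZMod 2) (c : K) (p q : (B →ₗ[K] B) × B) :
    pbrk A r s (c • p) q = c • pbrk A r s p q := by
  refine Prod.ext ?_ ?_ <;>
    simp [pbrk, LinearMap.smul_comp, LinearMap.comp_smul, smul_sub, smul_comm c]

theorem pbrk_add_right (r s : ZMod 2) (p q q' : (B →ₗ[K] B) × B) :
    pbrk A r s p (q + q') = pbrk A r s p q + pbrk A r s p q' := by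
  refine Prod.ext ?_ ?_
  · simp only [pbrk, Prod.fst_add, LinearMap.add_comp, LinearMap.comp_add, smul_add]
    abel
  · simp only [pbrk, Prod.fst_add, Prod.snd_add, LinearMap.add_apply, map_add, smul_add]
    abel

theorem pbrk_smul_right (r s : ZMod 2) (c : K) (p q : (B →ₗ[K] B) × B) :
    pbrk A r s p (c • q) = c • pbrk A r s p q := by
  refine Prod.ext ?_ ?_ <;>
    simp [pbrk, LinearMap.smul_comp, LinearMap.comp_smul, smul_sub, smul_comm c]

/-- The bracket of pairs maps `IPSpan A S r × IPSpan A T s` into a subspace as soon as the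
brackets of the inner pairs lie in it. -/
theorem pbrk_mem_of_inner {S T : ZMod 2 → Submodule K B} {r s : ZMod 2}
    {N : Submodule K ((B →ₗ[K] B) × B)}
    (h : ∀ i j k l x u y z, i + j = r → k + l = s → x ∈ A.g i → u ∈ S j → y ∈ A.g k → z ∈ T l →
      pbrk A r s (A.tri x u, A.mul x u) (A.tri y z, A.mul y z) ∈ N)
    {p q : (B →ₗ[K] B) × B} (hp : p ∈ IPSpan A S r) (hq : q ∈ IPSpan A T s) :
    pbrk A r s p q ∈ N := by
  let f : ((B →ₗ[K] B) × B) →ₗ[K] ((B →ₗ[K] B) × B) →ₗ[K] ((B →ₗ[K] B) × B) :=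
    LinearMap.mk₂ K (pbrk A r s) (A.pbrk_add_left r s) (A.pbrk_smul_left r s)
      (A.pbrk_add_right r s) (A.pbrk_smul_right r s)
  have hle : IPSpan A S r ≤ N.comap (f.flip q) := by
    refine Submodule.span_le.2 ?_
    rintro _ ⟨i, j, x, u, hij, hx, hu, rfl⟩
    have hle' : IPSpan A T s ≤ N.comap (f (A.tri x u, A.mul x u)) := by
      refine Submodule.span_le.2 ?_
      rintro _ ⟨k, l, y, z, hkl, hy, hz, rfl⟩
      exact h i j k l x u y z hij hkl hx hu hy hz
    exact hle' hq
  exact hle hp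

/-- If all inner maps `D_{x,u}` with `u` in `S` send `y` into `N`, so do their combinations. -/
theorem fst_apply_mem_of_inner {S : ZMod 2 → Submodule K B} {r : ZMod 2} {N : Submodule K B}
    {y : B} (h : ∀ i j x u, i + j = r → x ∈ A.g i → u ∈ S j → A.tri x u y ∈ N)
    {p : (B →ₗ[K] B) × B} (hp : p ∈ IPSpan A S r) : p.1 y ∈ N := by
  have hle : IPSpan A S r ≤
      N.comap (LinearMap.applyₗ y ∘ₗ LinearMap.fst K (B →ₗ[K] B) B) := by
    refine Submodule.span_le.2 ?_
    rintro _ ⟨i, j, x, u, hij, hx, hu, rfl⟩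
    exact h i j x u hij hx hu
  exact hle hp

end

end BolSuper

/-- if `J` is an ideal of the Bol superalgebra `B` (given by its
graded pieces), then `𝒥 = J ⊕ IPS(B,J)` is an ideal of the standard enveloping
Lie superalgebra `L(B) = B ⊕ IPS(B,B)`: the bracket of a homogeneous element of
`𝒥` with a homogeneous element of `L(B)` lies in `𝒥`. -/
theorem stmt5 {K B : Type*} [Field K] [CharZero K] [AddCommGroup B] [Module K B]
    (A : BolSuper K B) (J : ZMod 2 → Submodule K B)
    (hJg : ∀ r, J r ≤ A.g r)
    (hJmul : ∀ i j x u, x ∈ A.g i → u ∈ J j → A.mul x u ∈ J (i + j))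
    (hJtri1 : ∀ i j k x y u, x ∈ A.g i → y ∈ A.g j → u ∈ J k →
      A.tri x y u ∈ J (i + j + k))
    (hJtri2 : ∀ i j k x u y, x ∈ A.g i → u ∈ J j → y ∈ A.g k →
      A.tri x u y ∈ J (i + j + k)) :
    ∀ (r s : ZMod 2) (u v : B × ((B →ₗ[K] B) × B)),
      u.1 ∈ J r → u.2 ∈ IPSpan A J r → v.1 ∈ A.g s → v.2 ∈ IPSpan A A.g s →
      (lbrk A r s u v).1 ∈ J (r + s) ∧ (lbrk A r s u v).2 ∈ IPSpan A J (r + s) := by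
  intro r s u v hu hp hv hq
  refine ⟨sub_mem ?_ (Submodule.smul_mem _ _ ?_), ?_⟩
  · refine A.fst_apply_mem_of_inner (fun i j x w hij hx hw => ?_) hp
    exact hij ▸ hJtri2 i j s x w v.1 hx hw hv
  · refine A.fst_apply_mem_of_inner (fun i j x w hij hx hw => ?_) hq
    rw [add_comm r s]
    exact hij ▸ hJtri1 i j r x w u.1 hx hw hu
  · have hbb : (A.tri u.1 v.1, A.mul u.1 v.1) ∈ IPSpan A J (r + s) := by
      rw [A.tri_skew (hJg r hu) hv, A.bs1 r s _ _ (hJg r hu) hv]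
      exact neg_mem (Submodule.smul_mem _ _ (A.inner_mem (add_comm s r) hv hu))
    have hpp : pbrk A r s u.2 v.2 ∈ IPSpan A J (r + s) := by
      refine A.pbrk_mem_of_inner (fun i j k l x w y z hij hkl hx hw hy hz => ?_) hp hq
      subst hij hkl
      rw [A.pbrk_skew (A.mul_mem i j x w hx (hJg j hw)) (A.mul_mem k l y z hy hz),
        A.pbrk_inner hy hz hx (hJg j hw)]
      refine neg_mem (Submodule.smul_mem _ _ (add_mem ?_ (Submodule.smul_mem _ _ ?_)))
      · exact A.inner_mem (by abel) (A.tri_mem k l i y z x hy hz hx) hw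
      · exact A.inner_mem (by abel) hx (hJtri1 k l j y z w hy hz hw)
    exact add_mem hbb hpp
end

section
/- Let B be a finite-dimensional Bol superalgebra over a field K of characteristic 0 and let β be its Killing-Ricci form. If A is an automorphism of B, i.e. an even linear bijection A : B → B with A(x·y) = A(x)·A(y) and A([x,y,z]) = [A(x),A(y),A(z)] for all x,y,z ∈ B, then β(A(x),A(y)) = β(x,y) for all x,y ∈ B. -/
open LinearMap

variable {K B L : Type*} [Field K] [AddCommGroup B] [Module K B]

variable [AddCommGroup L] [Module K L]

theorem BolSuper.sup_eq_top (A : BolSuper K B) : A.g 0 ⊔ A.g 1 = ⊤ := by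
  rw [← A.internal.submodule_iSup_eq_top]
  refine le_antisymm (sup_le (le_iSup _ _) (le_iSup _ _)) (iSup_le fun i ↦ ?_)
  fin_cases i
  · exact le_sup_left
  · exact le_sup_right

theorem BolSuper.hom_ext {M : Type*} [AddCommGroup M] [Module K M] (A : BolSuper K B)
    {f g : B →ₗ[K] M} (h : ∀ i, ∀ x ∈ A.g i, f x = g x) : f = g := by
  ext x
  have hx : x ∈ A.g 0 ⊔ A.g 1 := A.sup_eq_top ▸ Submodule.mem_top
  obtain ⟨y, hy, z, hz, rfl⟩ := Submodule.mem_sup.1 hx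
  rw [map_add, map_add, h 0 y hy, h 1 z hz]

/-- The sum of the even and odd parts of the space of inner pairs. -/
def innerPairs (A : BolSuper K B) : Submodule K ((B →ₗ[K] B) × B) :=
  IPSpan A A.g 0 ⊔ IPSpan A A.g 1

theorem IPSpan_le_innerPairs (A : BolSuper K B) (r : ZMod 2) :
    IPSpan A A.g r ≤ innerPairs A := by
  fin_cases r
  · exact le_sup_left
  · exact le_sup_right

theorem pair_mem_IPSpan (A : BolSuper K B) {i j : ZMod 2} {x y : B}
    (hx : x ∈ A.g i) (hy : y ∈ A.g j) : (A.tri x y, A.mul x y) ∈ IPSpan A A.g (i + j) :=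
  Submodule.subset_span ⟨i, j, x, y, rfl, hx, hy, rfl⟩

/-- The action of a linear automorphism on pairs: `(P, a) ↦ (T P T⁻¹, T a)`. -/
def pairConj (T : B ≃ₗ[K] B) :
    ((B →ₗ[K] B) × B) ≃ₗ[K] ((B →ₗ[K] B) × B) :=
  T.conj.prodCongr T

theorem pairConj_pair (A : BolSuper K B) (T : B ≃ₗ[K] B)
    (hTmul : ∀ x y : B, T (A.mul x y) = A.mul (T x) (T y))
    (hTtri : ∀ x y z : B, T (A.tri x y z) = A.tri (T x) (T y) (T z)) (x y : B) :
    pairConj T (A.tri x y, A.mul x y) = (A.tri (T x) (T y), A.mul (T x) (T y)) := by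
  refine Prod.ext (LinearMap.ext fun z ↦ ?_) (hTmul x y)
  simp [pairConj, LinearEquiv.conj_apply, hTtri]

theorem pairConj_mem_IPSpan (A : BolSuper K B) (T : B ≃ₗ[K] B)
    (hTeven : ∀ (i : ZMod 2) (x : B), x ∈ A.g i → T x ∈ A.g i)
    (hTmul : ∀ x y : B, T (A.mul x y) = A.mul (T x) (T y))
    (hTtri : ∀ x y z : B, T (A.tri x y z) = A.tri (T x) (T y) (T z))
    {r : ZMod 2} {pa : (B →ₗ[K] B) × B} (h : pa ∈ IPSpan A A.g r) :
    pairConj T pa ∈ IPSpan A A.g r := by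
  have hle : IPSpan A A.g r ≤ (IPSpan A A.g r).comap (pairConj T).toLinearMap := by
    refine Submodule.span_le.2 ?_
    rintro _ ⟨i, j, x, u, rfl, hx, hu, rfl⟩
    change pairConj T _ ∈ IPSpan A A.g (i + j)
    rw [pairConj_pair A T hTmul hTtri]
    exact pair_mem_IPSpan A (hTeven i x hx) (hTeven j u hu)
  exact hle h

namespace EnvSetup

variable {A : BolSuper K B} (E : EnvSetup K B L A)

/-- The vector space decomposition of the enveloping Lie superalgebra. -/
noncomputable def decomp : (B × innerPairs A) ≃ₗ[K] L :=
  LinearEquiv.ofBijective (E.iota.coprod (E.jmap ∘ₗ (innerPairs A).subtype)) <| by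
    constructor
    · refine LinearMap.ker_eq_bot.1 (LinearMap.ker_eq_bot'.2 ?_)
      rintro ⟨x, pa, hpa⟩ h
      obtain ⟨rfl, rfl⟩ := E.inj x pa hpa (by simpa using h)
      rfl
    · intro v
      obtain ⟨x, pa, hpa, rfl⟩ := E.surj v
      exact ⟨(x, ⟨pa, hpa⟩), by simp⟩

theorem decomp_apply (x : B) (pa : innerPairs A) :
    E.decomp (x, pa) = E.iota x + E.jmap pa :=
  rfl

theorem hom_ext {M : Type*} [AddCommGroup M] [Module K M] {f g : L →ₗ[K] M}
    (hb : ∀ i, ∀ x ∈ A.g i, f (E.iota x) = g (E.iota x))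
    (hp : ∀ r, ∀ pa ∈ IPSpan A A.g r, f (E.jmap pa) = g (E.jmap pa)) : f = g := by
  ext v
  obtain ⟨x, pa, hpa, rfl⟩ := E.surj v
  obtain ⟨p, hp0, q, hq, rfl⟩ := Submodule.mem_sup.1 hpa
  have hx : f (E.iota x) = g (E.iota x) :=
    LinearMap.congr_fun (A.hom_ext (f := f ∘ₗ E.iota) (g := g ∘ₗ E.iota) hb) x
  simp only [map_add, hx, hp 0 p hp0, hp 1 q hq]

theorem iota_mem {r : ZMod 2} {x : B} (hx : x ∈ A.g r) : E.iota x ∈ E.gL r := by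
  rw [E.gL_eq]
  exact Submodule.mem_sup_left (Submodule.mem_map_of_mem hx)

theorem jmap_mem {r : ZMod 2} {pa : (B →ₗ[K] B) × B} (h : pa ∈ IPSpan A A.g r) :
    E.jmap pa ∈ E.gL r := by
  rw [E.gL_eq]
  exact Submodule.mem_sup_right (Submodule.mem_map_of_mem h)

theorem sigma_apply {r : ZMod 2} {v : L} (hv : v ∈ E.gL r) :
    E.sigma v = (-1 : K) ^ r.val • v := by
  fin_cases r
  · exact (E.sigma0 v hv).trans (by simp [ZMod.val])
  · exact (E.sigma1 v hv).trans (by simp [ZMod.val])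

/-- The extension to the enveloping Lie superalgebra of an invertible linear map of the
Bol superalgebra. -/
noncomputable def extend (T : B ≃ₗ[K] B) : L →ₗ[K] L :=
  ((E.iota ∘ₗ T.toLinearMap).coprod
    (E.jmap ∘ₗ (pairConj T).toLinearMap ∘ₗ (innerPairs A).subtype)) ∘ₗ
    E.decomp.symm.toLinearMap

theorem extend_add (T : B ≃ₗ[K] B) (x : B) {pa : (B →ₗ[K] B) × B} (h : pa ∈ innerPairs A) :
    E.extend T (E.iota x + E.jmap pa) = E.iota (T x) + E.jmap (pairConj T pa) := by
  rw [← E.decomp_apply x ⟨pa, h⟩]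
  simp [extend]

theorem extend_iota (T : B ≃ₗ[K] B) (x : B) : E.extend T (E.iota x) = E.iota (T x) := by
  simpa using E.extend_add T x (zero_mem _)

theorem extend_jmap (T : B ≃ₗ[K] B) {pa : (B →ₗ[K] B) × B} (h : pa ∈ innerPairs A) :
    E.extend T (E.jmap pa) = E.jmap (pairConj T pa) := by
  simpa using E.extend_add T 0 h

theorem extend_injective (T : B ≃ₗ[K] B)
    (hT : ∀ pa ∈ innerPairs A, pairConj T pa ∈ innerPairs A) :
    Function.Injective (E.extend T) := by
  refine LinearMap.ker_eq_bot.1 (LinearMap.ker_eq_bot'.2 fun v hv ↦ ?_)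
  obtain ⟨x, pa, hpa, rfl⟩ := E.surj v
  rw [E.extend_add T x hpa] at hv
  obtain ⟨hx, hp⟩ := E.inj _ _ (hT pa hpa) hv
  rw [(LinearEquiv.map_eq_zero_iff _).1 hx, (LinearEquiv.map_eq_zero_iff _).1 hp]
  simp

theorem sigma_comp_extend (T : B ≃ₗ[K] B)
    (hTeven : ∀ (i : ZMod 2) (x : B), x ∈ A.g i → T x ∈ A.g i)
    (hT : ∀ r, ∀ pa ∈ IPSpan A A.g r, pairConj T pa ∈ IPSpan A A.g r) :
    E.sigma ∘ₗ E.extend T = E.extend T ∘ₗ E.sigma := by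
  refine E.hom_ext (fun i x hx ↦ ?_) (fun r pa hpa ↦ ?_)
  · simp only [LinearMap.comp_apply, E.extend_iota, E.sigma_apply (E.iota_mem hx), map_smul,
      E.sigma_apply (E.iota_mem (hTeven i x hx))]
  · simp only [LinearMap.comp_apply, E.sigma_apply (E.jmap_mem hpa), map_smul,
      E.extend_jmap T (IPSpan_le_innerPairs A r hpa),
      E.sigma_apply (E.jmap_mem (hT r pa hpa))]

theorem brk_iota_comp_extend (T : B ≃ₗ[K] B)
    (hTeven : ∀ (i : ZMod 2) (x : B), x ∈ A.g i → T x ∈ A.g i)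
    (hTmul : ∀ x y : B, T (A.mul x y) = A.mul (T x) (T y))
    (hTtri : ∀ x y z : B, T (A.tri x y z) = A.tri (T x) (T y) (T z)) (x : B) :
    E.brk (E.iota (T x)) ∘ₗ E.extend T = E.extend T ∘ₗ E.brk (E.iota x) := by
  have key : (LinearMap.lcomp K L (E.extend T)) ∘ₗ E.brk ∘ₗ E.iota ∘ₗ T.toLinearMap =
      (LinearMap.compRight K (E.extend T)) ∘ₗ E.brk ∘ₗ E.iota := by
    refine A.hom_ext fun i x hx ↦ E.hom_ext (fun j y hy ↦ ?_) (fun r pa hpa ↦ ?_)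
    · change E.brk (E.iota (T x)) (E.extend T (E.iota y)) =
        E.extend T (E.brk (E.iota x) (E.iota y))
      rw [E.extend_iota, E.brk_bb, E.brk_bb, E.extend_jmap T
        (IPSpan_le_innerPairs A _ (pair_mem_IPSpan A hx hy)), pairConj_pair A T hTmul hTtri]
    · change E.brk (E.iota (T x)) (E.extend T (E.jmap pa)) =
        E.extend T (E.brk (E.iota x) (E.jmap pa))
      rw [E.extend_jmap T (IPSpan_le_innerPairs A r hpa), E.brk_bp i r x pa hx hpa,
        E.brk_bp i r _ _ (hTeven i x hx) (pairConj_mem_IPSpan A T hTeven hTmul hTtri hpa),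
        map_neg, map_smul, E.extend_iota]
      simp [pairConj, LinearEquiv.conj_apply]
  exact LinearMap.congr_fun key x

end EnvSetup

/-- the Killing-Ricci form of a finite-dimensional Bol
superalgebra is invariant under every automorphism of the Bol superalgebra. -/
theorem stmt8 {K B L : Type*} [Field K] [CharZero K]
    [AddCommGroup B] [Module K B] [FiniteDimensional K B]
    [AddCommGroup L] [Module K L] [FiniteDimensional K L]
    (A : BolSuper K B) (E : EnvSetup K B L A)
    (T : B →ₗ[K] B) (hTbij : Function.Bijective T)
    (hTeven : ∀ (i : ZMod 2) (x : B), x ∈ A.g i → T x ∈ A.g i)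
    (hTmul : ∀ x y : B, T (A.mul x y) = A.mul (T x) (T y))
    (hTtri : ∀ x y z : B, T (A.tri x y z) = A.tri (T x) (T y) (T z)) :
    ∀ x y : B, kr E (T x) (T y) = kr E x y := by
  let S : B ≃ₗ[K] B := LinearEquiv.ofBijective T hTbij
  have hIP (r) (pa) (h : pa ∈ IPSpan A A.g r) : pairConj S pa ∈ IPSpan A A.g r :=
    pairConj_mem_IPSpan A S hTeven hTmul hTtri h
  have hinner (pa) (h : pa ∈ innerPairs A) : pairConj S pa ∈ innerPairs A := by
    obtain ⟨p, hp, q, hq, rfl⟩ := Submodule.mem_sup.1 h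
    rw [map_add]
    exact Submodule.add_mem_sup (hIP 0 p hp) (hIP 1 q hq)
  let Φ : L ≃ₗ[K] L := LinearEquiv.ofInjectiveEndo _ (E.extend_injective S hinner)
  have hsigma (v : L) : E.sigma (Φ v) = Φ (E.sigma v) :=
    LinearMap.congr_fun (E.sigma_comp_extend S hTeven hIP) v
  have hbrk (x : B) (v : L) : E.brk (E.iota (T x)) (Φ v) = Φ (E.brk (E.iota x) v) :=
    LinearMap.congr_fun (E.brk_iota_comp_extend S hTeven hTmul hTtri x) v
  intro x y
  have hconj : E.sigma ∘ₗ E.brk (E.iota (T x)) ∘ₗ E.brk (E.iota (T y)) =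
      Φ.conj (E.sigma ∘ₗ E.brk (E.iota x) ∘ₗ E.brk (E.iota y)) := by
    ext v
    obtain ⟨w, rfl⟩ := Φ.surjective v
    simp [LinearEquiv.conj_apply, hbrk, hsigma]
  rw [kr, kr, killing, killing, hconj, LinearMap.trace_conj']
end

section
/- Let B be a Bol superalgebra over a field K of characteristic 0 and let b be an invariant form of B. Then b also satisfies, for all homogeneous x,y,z,u ∈ B: b([x,y,z],u) = −(−1)^{|z|(|x|+|y|)} b(z,[x,y,u]) and b(x,[y,z,u]) = (−1)^{|x||y|+|z||u|} b(y,[x,u,z]). -/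
open LinearMap

variable {K B L : Type*} [Field K] [AddCommGroup B] [Module K B]

variable [AddCommGroup L] [Module K L]

theorem sgn_mul_self (K : Type*) [Field K] (i j : ZMod 2) : sgn K i j * sgn K i j = 1 := by
  rw [sgn, ← pow_add, ← two_mul, pow_mul, neg_one_sq, one_pow]

/-- an invariant form `b` of a Bol superalgebra (supersymmetric,
satisfying `b(x·y,z) = -(-1)^{|x||y|} b(y,x·z)` and
`b([x,y,z],u) = -(-1)^{|y|(|z|+|u|)} b(x,[z,u,y])`) also satisfies
`b([x,y,z],u) = -(-1)^{|z|(|x|+|y|)} b(z,[x,y,u])` and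
`b(x,[y,z,u]) = (-1)^{|x||y|+|z||u|} b(y,[x,u,z])`. -/
theorem stmt10 {K B : Type*} [Field K] [CharZero K] [AddCommGroup B] [Module K B]
    (A : BolSuper K B) (b : B →ₗ[K] B →ₗ[K] K)
    (hsym : ∀ (i j : ZMod 2) (x y : B), x ∈ A.g i → y ∈ A.g j →
      b x y = sgn K i j * b y x)
    (hinv1 : ∀ (i j k : ZMod 2) (x y z : B), x ∈ A.g i → y ∈ A.g j → z ∈ A.g k →
      b (A.mul x y) z = -(sgn K i j * b y (A.mul x z)))
    (hinv2 : ∀ (i j k l : ZMod 2) (x y z u : B),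
      x ∈ A.g i → y ∈ A.g j → z ∈ A.g k → u ∈ A.g l →
      b (A.tri x y z) u = -(sgn K j (k + l) * b x (A.tri z u y))) :
    (∀ (i j k l : ZMod 2) (x y z u : B),
      x ∈ A.g i → y ∈ A.g j → z ∈ A.g k → u ∈ A.g l →
      b (A.tri x y z) u = -(sgn K k (i + j) * b z (A.tri x y u))) ∧
    (∀ (i j k l : ZMod 2) (x y z u : B),
      x ∈ A.g i → y ∈ A.g j → z ∈ A.g k → u ∈ A.g l →
      b x (A.tri y z u) = (sgn K i j * sgn K k l) * b y (A.tri x u z)) := by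
  have skew : ∀ (i j k l : ZMod 2) (x y z u : B),
      x ∈ A.g i → y ∈ A.g j → z ∈ A.g k → u ∈ A.g l →
      b (A.tri x y z) u = -(sgn K k (i + j) * b z (A.tri x y u)) := by
    intro i j k l x y z u hx hy hz hu
    rw [hinv2 i j k l x y z u hx hy hz hu,
      hsym i (k + l + j) x _ hx (A.tri_mem k l j z u y hz hu hy),
      hinv2 k l j i z u y x hz hu hy hx, A.bs2 j i l y x u hy hx hu]
    simp only [map_neg, map_smul, smul_eq_mul, sgn_add_right, sgn_comm K j i, sgn_comm K k i,
      sgn_comm K k j, sgn_comm K l i, sgn_comm K l j]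
    have hij := sgn_mul_self K i j
    have hil := sgn_mul_self K i l
    have hjl := sgn_mul_self K j l
    generalize b z (A.tri x y u) = c
    calc _ = -((sgn K i j * sgn K i j) * (sgn K i l * sgn K i l) * (sgn K j l * sgn K j l) *
          (sgn K i k * sgn K j k * c)) := by ring
      _ = _ := by rw [hij, hil, hjl]; ring
  refine ⟨skew, fun i j k l x y z u hx hy hz hu => ?_⟩
  have h₁ := hinv2 i l j k x u y z hx hu hy hz
  have h₂ := skew i l j k x u y z hx hu hy hz
  simp only [sgn_add_right, sgn_comm K j i, sgn_comm K l j, sgn_comm K l k] at h₁ h₂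
  have hjl := sgn_mul_self K j l
  have hkl := sgn_mul_self K k l
  generalize b x (A.tri y z u) = c at *
  generalize b y (A.tri x u z) = d at *
  have h := h₁.symm.trans h₂
  calc c = (sgn K j l * sgn K j l) * (sgn K k l * sgn K k l) * c := by rw [hjl, hkl]; ring
    _ = -(sgn K j l * sgn K k l * -(sgn K j l * sgn K k l * c)) := by ring
    _ = (sgn K j l * sgn K j l) * (sgn K i j * sgn K k l * d) := by rw [h]; ring
    _ = _ := by rw [hjl, one_mul]
end
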